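/- arXiv:2003.14264 — 3 statements merged into one kernel-verified Lean document; each statement's English description precedes it below -/
import Mathlib

section
/- A countable union of shy sets in a complete metric vector space is shy; equivalently, a countable intersection of prevalent sets is prevalent. -/
open MeasureTheory

/-- A Borel set `A` is shy if there is a Borel measure, positive and finite on some
compact set, giving zero measure to every translate of `A`. -/
def IsShyBorel {E : Type*} [NormedAddCommGroup E] [NormedSpace ℝ E] [MeasurableSpace E]
    (A : Set E) : Prop :=
  MeasurableSet A ∧ ∃ μ : Measure E,
    (∃ K : Set E, IsCompact K ∧ 0 < μ K ∧ μ K < ⊤) ∧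
    ∀ v : E, μ ((fun x => v + x) '' A) = 0

/-- A set is shy if it is contained in a shy Borel set. -/
def IsShy {E : Type*} [NormedAddCommGroup E] [NormedSpace ℝ E] [MeasurableSpace E]
    (A : Set E) : Prop :=
  ∃ B : Set E, A ⊆ B ∧ IsShyBorel B

/-- A set is prevalent if its complement is shy. -/
def IsPrevalent {E : Type*} [NormedAddCommGroup E] [NormedSpace ℝ E] [MeasurableSpace E]
    (A : Set E) : Prop :=
  IsShy Aᶜ

lemma shy_piece {E : Type*} [NormedAddCommGroup E] [NormedSpace ℝ E] [MeasurableSpace E]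
    [BorelSpace E] {B : Set E} (h : IsShyBorel B) {ε : ℝ} (hε : 0 < ε) :
    ∃ (L : Set E) (c : E), IsCompact L ∧ (∀ x ∈ L, ‖x - c‖ ≤ ε) ∧
      ∃ ν : Measure L, IsProbabilityMeasure ν ∧
        ∀ v : E, ν {x : L | (x : E) ∈ (fun x => v + x) '' B} = 0 := by
  obtain ⟨hB, μ, ⟨K, hK, hpos, hfin⟩, hz⟩ := h
  have : ∃ a ∈ K, μ (K ∩ Metric.closedBall a ε) ≠ 0 := by
    by_contra! hcon
    refine hpos.ne' (hK.measure_zero_of_nhdsWithin fun a ha => ⟨_, ?_, hcon a ha⟩)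
    exact Filter.inter_mem self_mem_nhdsWithin
      (mem_nhdsWithin_of_mem_nhds (Metric.closedBall_mem_nhds a hε))
  obtain ⟨a, ha, hne⟩ := this
  set L := K ∩ Metric.closedBall a ε with hL
  have hLc : IsCompact L := hK.inter_right Metric.isClosed_closedBall
  have hLm : MeasurableSet L := hLc.isClosed.measurableSet
  have hLfin : μ L ≠ ⊤ := ((measure_mono Set.inter_subset_left).trans_lt hfin).ne
  refine ⟨L, a, hLc, fun x hx => ?_, (μ L)⁻¹ • Measure.comap Subtype.val μ, ⟨?_⟩, fun v => ?_⟩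
  · simpa [dist_eq_norm] using hx.2
  · rw [Measure.smul_apply, comap_subtype_coe_apply hLm]
    simpa using ENNReal.inv_mul_cancel hne hLfin
  · rw [Measure.smul_apply, comap_subtype_coe_apply hLm]
    have : μ (Subtype.val '' {x : L | (x : E) ∈ (fun x => v + x) '' B}) = 0 := by
      refine measure_mono_null ?_ (hz v)
      rintro _ ⟨x, hx, rfl⟩
      exact hx
    simp only [this, smul_zero]

lemma infinitePi_update {X : ℕ → Type*} [∀ n, MeasurableSpace (X n)]
    (μ : ∀ n, Measure (X n)) [∀ n, IsProbabilityMeasure (μ n)] (n : ℕ) :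
    ((Measure.infinitePi μ).prod (μ n)).map
      (fun p : (∀ i, X i) × X n => Function.update p.1 n p.2) = Measure.infinitePi μ := by
  have hmeas : Measurable (fun p : (∀ i, X i) × X n => Function.update p.1 n p.2) := by
    rw [measurable_pi_iff]
    intro i
    by_cases h : i = n
    · subst h
      simpa using measurable_snd
    · simp only [Function.update_of_ne h]
      exact (measurable_pi_apply i).comp measurable_fst
  refine Measure.eq_infinitePi μ fun s t ht => ?_
  rw [Measure.map_apply hmeas (MeasurableSet.pi s.countable_toSet fun i _ => ht i)]
  by_cases hn : n ∈ s
  · have : (fun p : (∀ i, X i) × X n => Function.update p.1 n p.2) ⁻¹' (Set.pi s t)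
        = (Set.pi (s.erase n : Finset ℕ) t) ×ˢ (t n) := by
      ext p
      simp only [Set.mem_preimage, Set.mem_pi, Set.mem_prod, Finset.mem_coe, Finset.mem_erase]
      constructor
      · intro h
        refine ⟨fun i hi => ?_, ?_⟩
        · simpa [Function.update_of_ne hi.1] using h i hi.2
        · simpa using h n hn
      · rintro ⟨h1, h2⟩ i hi
        by_cases h : i = n
        · subst h
          simpa using h2
        · simpa [Function.update_of_ne h] using h1 i ⟨h, hi⟩
    rw [this, Measure.prod_prod, Measure.infinitePi_pi μ (fun i _ => ht i),
      Finset.prod_erase_mul _ _ hn]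
  · have : (fun p : (∀ i, X i) × X n => Function.update p.1 n p.2) ⁻¹' (Set.pi s t)
        = (Set.pi s t) ×ˢ Set.univ := by
      ext p
      simp only [Set.mem_preimage, Set.mem_pi, Set.mem_prod, Finset.mem_coe, Set.mem_univ,
        and_true]
      refine forall₂_congr fun i hi => ?_
      have h : i ≠ n := fun h => hn (h ▸ hi)
      rw [Function.update_of_ne h]
    rw [this, Measure.prod_prod, Measure.infinitePi_pi μ (fun i _ => ht i)]
    simp

lemma shyBorel_iUnion {E : Type*} [NormedAddCommGroup E] [NormedSpace ℝ E] [CompleteSpace E]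
    [MeasurableSpace E] [BorelSpace E] (B : ℕ → Set E) (h : ∀ n, IsShyBorel (B n)) :
    IsShyBorel (⋃ n, B n) := by
  have hε : ∀ n : ℕ, (0 : ℝ) < (1 / 2) ^ n := fun n => by positivity
  choose L c hLc hLb ν hν hz using fun n => shy_piece (h n) (hε n)
  haveI : ∀ n, CompactSpace (L n) := fun n => isCompact_iff_compactSpace.1 (hLc n)
  let S : (∀ n, L n) → E := fun y => ∑' n, ((y n : E) - c n)
  have hsum : ∀ y : (∀ n, L n), Summable fun n => ((y n : E) - c n) := fun y =>
    Summable.of_norm_bounded summable_geometric_two fun n => hLb n _ (y n).2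
  have hS : Continuous S := continuous_tsum (fun n => by fun_prop) summable_geometric_two
    (fun n y => hLb n _ (y n).2)
  have hSm : Measurable S := hS.measurable
  refine ⟨MeasurableSet.iUnion fun n => (h n).1, (Measure.infinitePi ν).map S,
    ⟨S '' Set.univ, isCompact_univ.image hS, ?_⟩, fun v => ?_⟩
  · rw [Measure.map_apply hSm (isCompact_univ.image hS).isClosed.measurableSet]
    have : S ⁻¹' (S '' Set.univ) = Set.univ := by
      ext; simp
    rw [this]
    simp
  · rw [Set.image_iUnion, measure_iUnion_null_iff]
    intro n
    have hm : ∀ v : E, MeasurableSet ((fun x => v + x) '' B n) := fun v =>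
      (Homeomorph.addLeft v).measurableEmbedding.measurableSet_image.2 (h n).1
    have hup : Measurable (fun p : (∀ i, L i) × L n => Function.update p.1 n p.2) := by
      refine Continuous.measurable ?_
      exact continuous_fst.update n continuous_snd
    rw [Measure.map_apply hSm (hm v), ← infinitePi_update ν n,
      Measure.map_apply hup (hSm (hm v)), Measure.measure_prod_null (hup (hSm (hm v)))]
    refine Filter.Eventually.of_forall fun y => ?_
    have key : ∀ x : L n, S (Function.update y n x) = (x : E) + (S y - y n) := by
      intro x
      have h1 : HasSum (Function.update (fun i => ((y i : E) - c i)) n ((x : E) - c n))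
          (((x : E) - c n) - ((y n : E) - c n) + S y) := (hsum y).hasSum.update n _
      have h2 : (fun i => ((Function.update y n x i : E) - c i))
          = Function.update (fun i => ((y i : E) - c i)) n ((x : E) - c n) := by
        funext i
        by_cases hi : i = n
        · subst hi; simp
        · simp [Function.update_of_ne hi]
      show ∑' i, ((Function.update y n x i : E) - c i) = _
      rw [h2, h1.tsum_eq]
      abel
    show ν n _ = 0
    convert hz n (v - (S y - y n)) using 2
    ext x
    simp only [Set.mem_preimage, Set.mem_setOf_eq, key, Set.mem_image]
    refine exists_congr fun b => and_congr_right fun _ => ?_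
    constructor
    · intro hb
      rw [sub_add_eq_add_sub, hb]
      abel
    · intro hb
      rw [← hb]
      abel

/-- A countable union of shy sets is shy; equivalently a countable intersection of
prevalent sets is prevalent. -/
theorem stmt1 {E : Type*} [NormedAddCommGroup E] [NormedSpace ℝ E] [CompleteSpace E]
    [MeasurableSpace E] [BorelSpace E] :
    (∀ A : ℕ → Set E, (∀ n, IsShy (A n)) → IsShy (⋃ n, A n)) ∧
    (∀ A : ℕ → Set E, (∀ n, IsPrevalent (A n)) → IsPrevalent (⋂ n, A n)) := by
  have key : ∀ A : ℕ → Set E, (∀ n, IsShy (A n)) → IsShy (⋃ n, A n) := by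
    intro A h
    choose B hAB hB using h
    exact ⟨⋃ n, B n, Set.iUnion_mono hAB, shyBorel_iUnion B hB⟩
  refine ⟨key, fun A h => ?_⟩
  unfold IsPrevalent
  rw [Set.compl_iInter]
  exact key _ h
end

section
/- Let γ, ν, ρ ∈ (0,1] with γ + νρ > 1 and A ∈ C^γ([0,T]; C^{1+ν}(ℝ^d;ℝ^d)). Then for any θ¹, θ² ∈ C^ρ([0,T];ℝ^d), ∫₀^t A(ds, θ¹_s) − ∫₀^t A(ds, θ²_s) = ∫₀^t (θ¹_s − θ²_s) · dV_s, where V_· = ∫₀¹ ∫₀^· ∇A(ds, θ²_s + x(θ¹_s − θ²_s)) dx belongs to C^γ([0,T]; L(ℝ^d;ℝ^d)) with ‖V‖_{C^γ} ≲ ‖A‖_{C^γ C^{1+ν}} (1 + [θ¹]_{C^ρ} + [θ²]_{C^ρ}), and the right-hand side is a Young integral. -/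
def IsPartition {n : ℕ} (s t : ℝ) (τ : Fin (n + 1) → ℝ) : Prop :=
  Monotone τ ∧ τ 0 = s ∧ τ (Fin.last n) = t

def MeshLE {n : ℕ} (τ : Fin (n + 1) → ℝ) (δ : ℝ) : Prop :=
  ∀ i : Fin n, τ i.succ - τ i.castSucc ≤ δ

/-- Nonlinear Young integral `∫_s^t A(du, θ_u)` as limit of Riemann–Stieltjes sums, for a
field `A` with values in a normed space `W`. -/
def IsNYIntegral {d : ℕ} {W : Type*} [NormedAddCommGroup W]
    (A : ℝ → (Fin d → ℝ) → W) (θ : ℝ → Fin d → ℝ) (s t : ℝ) (I : W) : Prop :=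
  ∀ ε > (0:ℝ), ∃ δ > (0:ℝ), ∀ (n : ℕ) (τ : Fin (n + 1) → ℝ),
    IsPartition s t τ → MeshLE τ δ →
      ‖(∑ i : Fin n,
          (A (τ i.succ) (θ (τ i.castSucc)) - A (τ i.castSucc) (θ (τ i.castSucc)))) - I‖ ≤ ε

/-- (Linear) Young integral `∫_s^t y_u · dV_u` as limit of Riemann–Stieltjes sums
`Σ_i (V_{t_{i+1}} - V_{t_i})(y_{t_i})`. -/
def IsLinYIntegral {d : ℕ} (V : ℝ → (Fin d → ℝ) →L[ℝ] (Fin d → ℝ)) (y : ℝ → Fin d → ℝ)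
    (s t : ℝ) (I : Fin d → ℝ) : Prop :=
  ∀ ε > (0:ℝ), ∃ δ > (0:ℝ), ∀ (n : ℕ) (τ : Fin (n + 1) → ℝ),
    IsPartition s t τ → MeshLE τ δ →
      ‖(∑ i : Fin n, (V (τ i.succ) - V (τ i.castSucc)) (y (τ i.castSucc))) - I‖ ≤ ε

lemma aux_rpow_half (β : ℝ) (n : ℕ) (T : ℝ) (hT : 0 < T) :
    (2:ℝ) ^ n * (T / 2 ^ n) ^ β = T ^ β * ((2:ℝ) ^ (1 - β)) ^ n := by
  rw [Real.div_rpow hT.le (by positivity)]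
  have h1 : ((2:ℝ) ^ n) ^ β = ((2:ℝ) ^ β) ^ n := by
    rw [← Real.rpow_natCast, ← Real.rpow_natCast, ← Real.rpow_mul (by norm_num),
      ← Real.rpow_mul (by norm_num), mul_comm]
  rw [h1, Real.rpow_sub (by norm_num), Real.rpow_one, div_pow]
  field_simp

lemma aux_ratio (β : ℝ) (hβ : 1 < β) : (2:ℝ) ^ (1 - β) < 1 :=
  Real.rpow_lt_one_of_one_lt_of_neg (by norm_num) (by linarith)

lemma max_ineq {E : Type*} [NormedAddCommGroup E] (Ξ : ℝ → ℝ → E) (M β C T : ℝ)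
    (hβ : 1 < β) (hM : 0 ≤ M) (hC : C = 2 / (1 - (2:ℝ) ^ (1 - β)))
    (hΞ0 : ∀ u, Ξ u u = 0)
    (hδ : ∀ s u t, 0 ≤ s → s ≤ u → u ≤ t → t ≤ T →
      ‖Ξ s t - Ξ s u - Ξ u t‖ ≤ M * (t - s) ^ β)
    (p : ℕ → ℝ) (hp : Monotone p) (hp0 : ∀ k, p k ∈ Set.Icc 0 T) :
    ∀ n a, ‖∑ i ∈ Finset.range n, Ξ (p (a + i)) (p (a + i + 1)) - Ξ (p a) (p (a + n))‖
      ≤ C * M * (p (a + n) - p a) ^ β := by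
  have hr := aux_ratio β hβ
  have hCpos : 0 < C := by rw [hC]; exact div_pos two_pos (by linarith)
  have hCr : C * (2:ℝ) ^ (1 - β) + 2 = C := by
    have : (1 - (2:ℝ) ^ (1 - β)) ≠ 0 := by linarith
    have h2 : C * (1 - (2:ℝ) ^ (1 - β)) = 2 := by rw [hC]; field_simp
    linarith
  intro n
  induction n using Nat.strong_induction_on with
  | _ n ih =>
  intro a
  rcases Nat.eq_zero_or_pos n with rfl | hn
  · simp [hΞ0, Real.zero_rpow (by linarith : β ≠ 0)]
  set L := p (a + n) - p a with hL
  have hL0 : 0 ≤ L := sub_nonneg.2 (hp (by omega))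
  obtain ⟨j, hjn, hj1, hj2⟩ : ∃ j < n, p (a + j) - p a ≤ L / 2 ∧ L / 2 ≤ p (a + j + 1) - p a := by
    by_contra! hcon
    have key : ∀ j, j ≤ n → p (a + j) - p a ≤ L / 2 := by
      intro j
      induction j with
      | zero => intro _; simp; linarith
      | succ j ihj => intro h; exact (hcon j (by omega) (ihj (by omega))).le
    obtain ⟨m, rfl⟩ : ∃ m, n = m + 1 := ⟨n - 1, by omega⟩
    have := hcon m (by omega) (key m (by omega))
    rw [← add_assoc] at hL
    linarith
  obtain ⟨m, rfl⟩ : ∃ m, n = j + 1 + m := ⟨n - (j + 1), by omega⟩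
  have i1 := ih j (by omega) a
  have i2 := ih m (by omega) (a + j + 1)
  have e : a + j + 1 + m = a + (j + 1 + m) := by omega
  rw [e] at i2
  have m1 : p a ≤ p (a + j) := hp (by omega)
  have m2 : p (a + j) ≤ p (a + j + 1) := hp (by omega)
  have m3 : p (a + j + 1) ≤ p (a + (j + 1 + m)) := hp (by omega)
  have d1 := hδ (p a) (p (a + j)) (p (a + (j + 1 + m))) (hp0 _).1 m1 (m2.trans m3) (hp0 _).2
  have d2 := hδ (p (a + j)) (p (a + j + 1)) (p (a + (j + 1 + m))) (hp0 _).1 m2 m3 (hp0 _).2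
  have b1 : (p (a + j) - p a) ^ β ≤ (L / 2) ^ β :=
    Real.rpow_le_rpow (by linarith) hj1 (by linarith)
  have b2 : (p (a + (j + 1 + m)) - p (a + j + 1)) ^ β ≤ (L / 2) ^ β :=
    Real.rpow_le_rpow (by linarith) (by linarith) (by linarith)
  have b3 : (p (a + (j + 1 + m)) - p (a + j)) ^ β ≤ L ^ β :=
    Real.rpow_le_rpow (by linarith) (by linarith) (by linarith)
  have hhalf : 2 * (L / 2) ^ β = L ^ β * (2:ℝ) ^ (1 - β) := by
    rw [Real.div_rpow hL0 (by norm_num), Real.rpow_sub (by norm_num), Real.rpow_one]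
    ring
  rw [Finset.sum_range_add, Finset.sum_range_succ]
  have e2 : ∀ x, p (a + (j + 1 + x)) = p (a + j + 1 + x) := fun x => by congr 1; omega
  have e3 : ∀ x, p (a + (j + 1 + x) + 1) = p (a + j + 1 + x + 1) := fun x => by congr 1; omega
  have e4 : ∑ x ∈ Finset.range m, Ξ (p (a + (j + 1 + x))) (p (a + (j + 1 + x) + 1))
     = ∑ x ∈ Finset.range m, Ξ (p (a + j + 1 + x)) (p (a + j + 1 + x + 1)) :=
    Finset.sum_congr rfl fun x _ => by rw [e2, e3]
  rw [e4]
  set S1 := ∑ x ∈ Finset.range j, Ξ (p (a + x)) (p (a + x + 1))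
  set S2 := ∑ x ∈ Finset.range m, Ξ (p (a + j + 1 + x)) (p (a + j + 1 + x + 1))
  set q := p (a + (j + 1 + m))
  have id : S1 + Ξ (p (a + j)) (p (a + j + 1)) + S2 - Ξ (p a) q =
      (S1 - Ξ (p a) (p (a + j))) + (S2 - Ξ (p (a + j + 1)) q)
      - (Ξ (p a) q - Ξ (p a) (p (a + j)) - Ξ (p (a + j)) q)
      - (Ξ (p (a + j)) q - Ξ (p (a + j)) (p (a + j + 1)) - Ξ (p (a + j + 1)) q) := by abel
  rw [id]
  refine (norm_sub_le _ _).trans ?_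
  refine (add_le_add_left ((norm_sub_le _ _).trans (add_le_add_left (norm_add_le _ _) _)) _).trans ?_
  have hCM : 0 ≤ C * M := by positivity
  have c1 := mul_le_mul_of_nonneg_left b1 hCM
  have c2 := mul_le_mul_of_nonneg_left b2 hCM
  have c3 := mul_le_mul_of_nonneg_left b3 hM
  have fin : C * M * L ^ β = C * M * (2 * (L / 2) ^ β) + 2 * (M * L ^ β) := by
    rw [hhalf]; nth_rewrite 1 [← hCr]; ring
  rw [fin]
  linarith

/-- dyadic sums -/
noncomputable def dySum {E : Type*} [NormedAddCommGroup E] (Ξ : ℝ → ℝ → E) (T : ℝ) (n : ℕ)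
    (t : ℝ) : E :=
  ∑ k ∈ Finset.range (2 ^ n), Ξ (min (k * (T / 2 ^ n)) t) (min ((k + 1 : ℕ) * (T / 2 ^ n)) t)

lemma sum_double {E : Type*} [AddCommGroup E] (f : ℕ → E) (n : ℕ) :
    ∑ k ∈ Finset.range (2 * n), f k = ∑ k ∈ Finset.range n, (f (2 * k) + f (2 * k + 1)) := by
  induction n with
  | zero => simp
  | succ n ih =>
    rw [Finset.sum_range_succ, ← ih, show 2 * (n + 1) = 2 * n + 1 + 1 by ring,
      Finset.sum_range_succ, Finset.sum_range_succ, add_assoc]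

lemma sewing {E : Type*} [NormedAddCommGroup E] [CompleteSpace E]
    (Ξ : ℝ → ℝ → E) (M β C T : ℝ) (hT : 0 < T)
    (hβ : 1 < β) (hM : 0 ≤ M) (hC : C = 2 / (1 - (2:ℝ) ^ (1 - β)))
    (hΞ0 : ∀ u, Ξ u u = 0)
    (hδ : ∀ s u t, 0 ≤ s → s ≤ u → u ≤ t → t ≤ T →
      ‖Ξ s t - Ξ s u - Ξ u t‖ ≤ M * (t - s) ^ β) :
    ∃ Φ : ℝ → E, (∀ t ∈ Set.Icc 0 T, Filter.Tendsto (fun n => dySum Ξ T n t) Filter.atTop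
        (nhds (Φ t))) ∧ Φ 0 = 0 ∧
      ∀ s t, 0 ≤ s → s ≤ t → t ≤ T → ‖Φ t - Φ s - Ξ s t‖ ≤ C * M * (t - s) ^ β := by
  have hr := aux_ratio β hβ
  have hcau : ∀ t ∈ Set.Icc 0 T, CauchySeq (fun n => dySum Ξ T n t) := by
    intro t ht
    refine cauchySeq_of_le_geometric ((2:ℝ) ^ (1 - β)) (M * T ^ β) hr fun n => ?_
    rw [mul_assoc, ← aux_rpow_half β n T hT, dist_eq_norm]
    unfold dySum
    rw [pow_succ' 2 n, sum_double, ← Finset.sum_sub_distrib]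
    have hh : 0 < T / 2 ^ n := by positivity
    have : M * (2 ^ n * (T / 2 ^ n) ^ β) = ∑ k ∈ Finset.range (2 ^ n), M * (T / 2 ^ n) ^ β := by
      simp; ring
    rw [this]
    refine norm_sum_le_of_le _ fun k hk => ?_
    have e0 : T / 2 ^ (n + 1) = (T / 2 ^ n) / 2 := by rw [pow_succ]; field_simp
    have e0' : T / (2 * 2 ^ n) = (T / 2 ^ n) / 2 := by field_simp
    have e1 : ((2 * k : ℕ) : ℝ) * (T / 2 ^ n / 2) = k * (T / 2 ^ n) := by push_cast; ring
    have e2 : ((2 * k + 1 + 1 : ℕ) : ℝ) * (T / 2 ^ n / 2) = (k + 1 : ℕ) * (T / 2 ^ n) := by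
      push_cast; ring
    simp only [e0, e1, e2]
    set h := T / 2 ^ n
    set x := (k : ℝ) * h with hx
    have hx0 : 0 ≤ x := by positivity
    set y := ((2 * k + 1 : ℕ) : ℝ) * (h / 2) with hy
    set z := ((k + 1 : ℕ) : ℝ) * h with hz
    have hxy : x ≤ y := by rw [hx, hy]; push_cast; nlinarith
    have hyz : y ≤ z := by rw [hz, hy]; push_cast; nlinarith
    have hzx : z = x + h := by rw [hx, hz]; push_cast; ring
    rw [← sub_sub]
    refine (hδ (min x t) (min y t) (min z t) (le_min hx0 ht.1) (min_le_min_right _ hxy)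
      (min_le_min_right _ hyz) ((min_le_right _ _).trans ht.2)).trans ?_
    have q1 : min z t ≤ min x t + h := by
      rw [hzx]
      rcases le_total x t with h1 | h1
      · rw [min_eq_left h1]; exact min_le_left _ _
      · rw [min_eq_right h1]; exact (min_le_right _ _).trans (by linarith)
    have q2 : min x t ≤ min z t := min_le_min_right _ (hxy.trans hyz)
    exact mul_le_mul_of_nonneg_left (Real.rpow_le_rpow (by linarith) (by linarith)
      (by linarith)) hM
  have hlim : ∀ t, ∃ φ, t ∈ Set.Icc 0 T →
      Filter.Tendsto (fun n => dySum Ξ T n t) Filter.atTop (nhds φ) := by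
    intro t
    by_cases ht : t ∈ Set.Icc 0 T
    · obtain ⟨φ, h⟩ := cauchySeq_tendsto_of_complete (hcau t ht)
      exact ⟨φ, fun _ => h⟩
    · exact ⟨0, fun h => absurd h ht⟩
  choose Φ hΦ using hlim
  refine ⟨Φ, hΦ, ?_, ?_⟩
  · have h0 : (fun n => dySum Ξ T n 0) = fun _ => 0 := by
      funext n
      unfold dySum
      refine Finset.sum_eq_zero fun k _ => ?_
      rw [min_eq_right (by positivity), min_eq_right (by positivity), hΞ0]
    have := hΦ 0 ⟨le_rfl, hT.le⟩
    rw [h0] at this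
    exact tendsto_nhds_unique this tendsto_const_nhds
  intro s t hs hst htT
  have hlim1 : Filter.Tendsto (fun n => ‖dySum Ξ T n t - dySum Ξ T n s - Ξ s t‖) Filter.atTop
      (nhds ‖Φ t - Φ s - Ξ s t‖) :=
    (((hΦ t ⟨hs.trans hst, htT⟩).sub (hΦ s ⟨hs, hst.trans htT⟩)).sub_const _).norm
  have hlim2 : Filter.Tendsto (fun n : ℕ => C * M * (t - s) ^ β + M * (T ^ β * ((2:ℝ) ^ (1 - β)) ^ n))
      Filter.atTop (nhds (C * M * (t - s) ^ β + M * (T ^ β * 0))) :=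
    (((tendsto_pow_atTop_nhds_zero_of_lt_one (by positivity) hr).const_mul _).const_mul _).const_add _
  rw [mul_zero, mul_zero, add_zero] at hlim2
  refine le_of_tendsto_of_tendsto' hlim1 hlim2 fun n => ?_
  rw [← aux_rpow_half β n T hT]
  have hh : 0 < T / 2 ^ n := by positivity
  set h := T / 2 ^ n with hhd
  set p : ℕ → ℝ := fun k => max s (min (k * h) t) with hp
  have hpm : Monotone p := by
    intro a b hab
    have : (a : ℝ) * h ≤ b * h := mul_le_mul_of_nonneg_right (by exact_mod_cast hab) hh.le
    exact max_le_max_left _ (min_le_min_right _ this)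
  have hpI : ∀ k, p k ∈ Set.Icc 0 T := fun k =>
    ⟨hs.trans (le_max_left _ _), max_le (hst.trans htT) ((min_le_right _ _).trans htT)⟩
  have mx := max_ineq Ξ M β C T hβ hM hC hΞ0 hδ p hpm hpI (2 ^ n) 0
  have p0 : p 0 = s := by
    simp only [hp]; rw [max_eq_left]; exact (min_le_left _ _).trans (by simpa using hs)
  have p1 : p (2 ^ n) = t := by
    simp only [hp]
    have : ((2 ^ n : ℕ) : ℝ) * h = T := by rw [hhd]; push_cast; field_simp
    rw [this, min_eq_right htT, max_eq_right hst]
  simp only [zero_add, p0, p1] at mx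
  have key : ‖dySum Ξ T n t - dySum Ξ T n s - ∑ i ∈ Finset.range (2 ^ n), Ξ (p i) (p (i + 1))‖
      ≤ M * (2 ^ n * h ^ β) := by
    unfold dySum
    rw [← Finset.sum_sub_distrib, ← Finset.sum_sub_distrib]
    have : M * (2 ^ n * h ^ β) = ∑ k ∈ Finset.range (2 ^ n), M * h ^ β := by
      simp; ring
    rw [this]
    refine norm_sum_le_of_le _ fun k hk => ?_
    simp only [hp, ← hhd]
    have hpos : 0 ≤ M * h ^ β := by positivity
    set x := (k : ℝ) * h with hx
    have hx0 : 0 ≤ x := by positivity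
    have hz : ((k + 1 : ℕ) : ℝ) * h = x + h := by rw [hx]; push_cast; ring
    rw [hz]
    rcases le_total s x with h1 | h1
    · rw [min_eq_right h1, min_eq_right (by linarith : s ≤ x + h), hΞ0,
        max_eq_right (le_min h1 hst), max_eq_right (le_min (by linarith) hst)]
      simpa using hpos
    rcases le_total (x + h) s with h2 | h2
    · rw [min_eq_left h1, min_eq_left h2, min_eq_left (h1.trans hst), min_eq_left (h2.trans hst),
        max_eq_left h1, max_eq_left h2, hΞ0]
      simpa using hpos
    · rw [min_eq_left h1, min_eq_right h2, min_eq_left (h1.trans hst), max_eq_left h1,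
        max_eq_right (le_min h2 hst)]
      refine (hδ _ _ _ hx0 h1 (le_min h2 hst) ((min_le_right _ _).trans htT)).trans ?_
      have q1 : min (x + h) t ≤ x + h := min_le_left _ _
      have q2 : s ≤ min (x + h) t := le_min h2 hst
      exact mul_le_mul_of_nonneg_left (Real.rpow_le_rpow (by linarith) (by linarith)
        (by linarith)) hM
  calc _ = ‖(dySum Ξ T n t - dySum Ξ T n s - ∑ i ∈ Finset.range (2 ^ n), Ξ (p i) (p (i + 1)))
      + (∑ i ∈ Finset.range (2 ^ n), Ξ (p i) (p (i + 1)) - Ξ s t)‖ := by congr 1; abel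
    _ ≤ _ := norm_add_le _ _
    _ ≤ _ := by linarith

lemma part_mem {n : ℕ} {τ : Fin (n + 1) → ℝ} {t T : ℝ} (ht : t ∈ Set.Icc 0 T)
    (h : IsPartition 0 t τ) (i : Fin (n + 1)) : τ i ∈ Set.Icc 0 T := by
  obtain ⟨hm, h0, h1⟩ := h
  exact ⟨h0 ▸ hm (Fin.zero_le i), (hm (Fin.le_last i)).trans (h1 ▸ ht.2)⟩

lemma sum_tele {E : Type*} [AddCommGroup E] {n : ℕ} (τ : Fin (n + 1) → ℝ) (f : ℝ → E) :
    ∑ i : Fin n, (f (τ i.succ) - f (τ i.castSucc)) = f (τ (Fin.last n)) - f (τ 0) := by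
  induction n with
  | zero => simp
  | succ n ih =>
    rw [Fin.sum_univ_castSucc]
    have := ih (fun i => τ i.castSucc)
    simp only [Fin.succ_castSucc, Fin.castSucc_zero, Fin.succ_last] at this ⊢
    rw [this]; abel

lemma part_small (β M T : ℝ) (hβ : 1 < β) (hM : 0 ≤ M) (hT : 0 < T) :
    ∀ ε > (0:ℝ), ∃ δ > (0:ℝ), ∀ t ∈ Set.Icc 0 T, ∀ (n : ℕ) (τ : Fin (n + 1) → ℝ),
      IsPartition 0 t τ → MeshLE τ δ →
      ∑ i : Fin n, M * (τ i.succ - τ i.castSucc) ^ β ≤ ε := by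
  intro ε hε
  have hlim : Filter.Tendsto (fun δ : ℝ => M * δ ^ (β - 1) * T) (nhdsWithin 0 (Set.Ioi 0))
      (nhds 0) := by
    have : ContinuousAt (fun δ : ℝ => M * δ ^ (β - 1) * T) 0 :=
      ((Real.continuousAt_rpow_const _ _ (Or.inr (by linarith))).const_mul M).mul_const T
    have h := this.tendsto
    simp only [Real.zero_rpow (by linarith : β - 1 ≠ 0), mul_zero, zero_mul] at h
    exact h.mono_left nhdsWithin_le_nhds
  obtain ⟨δ, h1, h2⟩ := ((hlim.eventually (gt_mem_nhds hε)).and self_mem_nhdsWithin).exists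
  have hδ : 0 < δ := h2
  refine ⟨δ, hδ, fun t ht n τ hp hm => ?_⟩
  calc _ ≤ ∑ i : Fin n, M * δ ^ (β - 1) * (τ i.succ - τ i.castSucc) := by
        refine Finset.sum_le_sum fun i _ => ?_
        rw [mul_assoc]
        refine mul_le_mul_of_nonneg_left ?_ hM
        have h0 : 0 ≤ τ i.succ - τ i.castSucc :=
          sub_nonneg.2 (hp.1 (Fin.castSucc_lt_succ).le)
        rcases h0.eq_or_lt with h | h
        · rw [← h, Real.zero_rpow (by linarith), mul_zero]
        · conv_lhs => rw [show β = (β - 1) + 1 by ring, Real.rpow_add h, Real.rpow_one]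
          exact mul_le_mul_of_nonneg_right (Real.rpow_le_rpow h0 (hm i) (by linarith)) h0
    _ = M * δ ^ (β - 1) * t := by
        rw [← Finset.mul_sum, sum_tele τ (fun x => x), hp.2.1, hp.2.2, sub_zero]
    _ ≤ M * δ ^ (β - 1) * T := mul_le_mul_of_nonneg_left ht.2 (by positivity)
    _ ≤ ε := le_of_lt h1

/-- If `A ∈ C^γ_t C^{1+ν}_x` (spatial derivative `DA = ∇A`, norm bound `NA`) and
`θ1, θ2 ∈ C^ρ` with `γ + νρ > 1`, then
`∫₀^t A(ds,θ1_s) - ∫₀^t A(ds,θ2_s) = ∫₀^t (θ1_s - θ2_s)·dV_s` where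
`V_· = ∫₀¹ ∫₀^· ∇A(ds, θ2_s + x(θ1_s - θ2_s)) dx` belongs to `C^γ([0,T];L(ℝ^d;ℝ^d))`
with `‖V‖_{C^γ} ≲ ‖A‖_{C^γ C^{1+ν}} (1 + [θ1]_{C^ρ} + [θ2]_{C^ρ})`; here the inner
integral defining `V` is a nonlinear Young integral of the operator-valued field `∇A` and
the outer one a Bochner integral in `x ∈ [0,1]`. -/
theorem stmt12 (γ ν ρ T : ℝ) (hγ : γ ∈ Set.Ioc (0:ℝ) 1) (hν : ν ∈ Set.Ioc (0:ℝ) 1)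
    (hρ : ρ ∈ Set.Ioc (0:ℝ) 1) (hsum : 1 < γ + ν * ρ) (hT : 0 < T) :
    ∃ C : ℝ, 0 < C ∧
      ∀ (d : ℕ) (A : ℝ → (Fin d → ℝ) → Fin d → ℝ)
        (DA : ℝ → (Fin d → ℝ) → (Fin d → ℝ) →L[ℝ] (Fin d → ℝ))
        (θ1 θ2 : ℝ → Fin d → ℝ) (I1 I2 : ℝ → Fin d → ℝ) (NA K₁ K₂ : ℝ),
      (∀ t x, HasFDerivAt (A t) (DA t x) x) →
      (∀ t ∈ Set.Icc 0 T, ∀ x : Fin d → ℝ, ‖A t x‖ ≤ NA ∧ ‖DA t x‖ ≤ NA) →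
      (∀ t ∈ Set.Icc 0 T, ∀ x y : Fin d → ℝ, ‖DA t x - DA t y‖ ≤ NA * ‖x - y‖ ^ ν) →
      (∀ s ∈ Set.Icc 0 T, ∀ t ∈ Set.Icc 0 T, ∀ x : Fin d → ℝ,
        ‖A t x - A s x‖ ≤ NA * |t - s| ^ γ ∧ ‖DA t x - DA s x‖ ≤ NA * |t - s| ^ γ) →
      (∀ s ∈ Set.Icc 0 T, ∀ t ∈ Set.Icc 0 T, ∀ x y : Fin d → ℝ,
        ‖DA t x - DA t y - (DA s x - DA s y)‖ ≤ NA * |t - s| ^ γ * ‖x - y‖ ^ ν) →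
      (∀ s ∈ Set.Icc 0 T, ∀ t ∈ Set.Icc 0 T, ‖θ1 t - θ1 s‖ ≤ K₁ * |t - s| ^ ρ) →
      (∀ s ∈ Set.Icc 0 T, ∀ t ∈ Set.Icc 0 T, ‖θ2 t - θ2 s‖ ≤ K₂ * |t - s| ^ ρ) →
      (∀ t ∈ Set.Icc 0 T, IsNYIntegral A θ1 0 t (I1 t)) →
      (∀ t ∈ Set.Icc 0 T, IsNYIntegral A θ2 0 t (I2 t)) →
      ∃ (V : ℝ → (Fin d → ℝ) →L[ℝ] (Fin d → ℝ))
        (J : ℝ → ℝ → (Fin d → ℝ) →L[ℝ] (Fin d → ℝ)),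
        (∀ x ∈ Set.Icc (0:ℝ) 1, ∀ t ∈ Set.Icc 0 T,
          IsNYIntegral DA (fun s => θ2 s + x • (θ1 s - θ2 s)) 0 t (J x t)) ∧
        (∀ t ∈ Set.Icc 0 T, V t = ∫ x in Set.Icc (0:ℝ) 1, J x t) ∧
        (∀ s ∈ Set.Icc 0 T, ∀ t ∈ Set.Icc 0 T,
          ‖V t - V s‖ ≤ C * NA * (1 + K₁ + K₂) * |t - s| ^ γ) ∧
        (∀ t ∈ Set.Icc 0 T, IsLinYIntegral V (fun s => θ1 s - θ2 s) 0 t (I1 t - I2 t)) := by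

  obtain ⟨hγ0, hγ1⟩ := hγ
  obtain ⟨hν0, hν1⟩ := hν
  obtain ⟨hρ0, hρ1⟩ := hρ
  set β := γ + ν * ρ with hβdef
  set Cβ : ℝ := 2 / (1 - (2:ℝ) ^ (1 - β)) with hCβ
  have hr := aux_ratio β hsum
  have hCβpos : 0 < Cβ := by rw [hCβ]; exact div_pos two_pos (by linarith)
  refine ⟨1 + Cβ * T ^ (ν * ρ), by positivity, ?_⟩
  intro d A DA θ1 θ2 I1 I2 NA K₁ K₂ hD hB hH hT1 hT2 hθ1 hθ2 hI1 hI2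
  have h0T : (0:ℝ) ∈ Set.Icc 0 T := ⟨le_rfl, hT.le⟩
  have hTT : T ∈ Set.Icc 0 T := ⟨hT.le, le_rfl⟩
  have hNA : 0 ≤ NA := (norm_nonneg _).trans (hB 0 h0T 0).1
  have hTρ : 0 < |T - 0| ^ ρ := Real.rpow_pos_of_pos (by simpa using hT.ne') _
  have hK1 : 0 ≤ K₁ := by
    have := (norm_nonneg _).trans (hθ1 0 h0T T hTT)
    exact nonneg_of_mul_nonneg_left this hTρ
  have hK2 : 0 ≤ K₂ := by
    have := (norm_nonneg _).trans (hθ2 0 h0T T hTT)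
    exact nonneg_of_mul_nonneg_left this hTρ
  set K := K₁ + K₂ with hK
  have hK0 : 0 ≤ K := add_nonneg hK1 hK2
  set θ : ℝ → ℝ → Fin d → ℝ := fun x s => θ2 s + x • (θ1 s - θ2 s) with hθdef
  have hθ : ∀ x ∈ Set.Icc (0:ℝ) 1, ∀ s ∈ Set.Icc 0 T, ∀ t ∈ Set.Icc 0 T,
      ‖θ x t - θ x s‖ ≤ K * |t - s| ^ ρ := by
    intro x hx s hs t ht
    have e : θ x t - θ x s = (1 - x) • (θ2 t - θ2 s) + x • (θ1 t - θ1 s) := by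
      simp only [hθdef]; module
    rw [e]
    refine (norm_add_le _ _).trans ?_
    rw [norm_smul, norm_smul, Real.norm_of_nonneg (by linarith [hx.2] : 0 ≤ 1 - x),
      Real.norm_of_nonneg hx.1]
    have a1 := mul_le_of_le_one_left (norm_nonneg (θ2 t - θ2 s)) (by linarith [hx.1] : 1 - x ≤ 1)
    have a2 := mul_le_of_le_one_left (norm_nonneg (θ1 t - θ1 s)) hx.2
    have := hθ1 s hs t ht
    have := hθ2 s hs t ht
    rw [hK, add_mul]
    linarith
  set M := NA * K ^ ν with hMdef
  have hM : 0 ≤ M := by positivity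
  set Ξ : ℝ → ℝ → ℝ → (Fin d → ℝ) →L[ℝ] (Fin d → ℝ) :=
    fun x u v => DA v (θ x u) - DA u (θ x u) with hΞ
  have hδ : ∀ x ∈ Set.Icc (0:ℝ) 1, ∀ s u t, 0 ≤ s → s ≤ u → u ≤ t → t ≤ T →
      ‖Ξ x s t - Ξ x s u - Ξ x u t‖ ≤ M * (t - s) ^ β := by
    intro x hx s u t hs hsu hut htT
    have hsI : s ∈ Set.Icc 0 T := ⟨hs, by linarith⟩
    have huI : u ∈ Set.Icc 0 T := ⟨by linarith, by linarith⟩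
    have htI : t ∈ Set.Icc 0 T := ⟨by linarith, by linarith⟩
    have e : Ξ x s t - Ξ x s u - Ξ x u t =
        DA t (θ x s) - DA t (θ x u) - (DA u (θ x s) - DA u (θ x u)) := by
      simp only [hΞ]; abel
    rw [e]
    refine (hT2 u huI t htI _ _).trans ?_
    have h1 : ‖θ x s - θ x u‖ ≤ K * (t - s) ^ ρ := by
      refine (hθ x hx u huI s hsI).trans ?_
      rw [abs_sub_comm, abs_of_nonneg (by linarith)]
      exact mul_le_mul_of_nonneg_left (Real.rpow_le_rpow (by linarith) (by linarith) hρ0.le) hK0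
    have hts : 0 ≤ t - s := by linarith
    have h2 : ‖θ x s - θ x u‖ ^ ν ≤ K ^ ν * (t - s) ^ (ν * ρ) := by
      refine (Real.rpow_le_rpow (norm_nonneg _) h1 hν0.le).trans ?_
      rw [Real.mul_rpow hK0 (by positivity), ← Real.rpow_mul hts, mul_comm ρ ν]
    have h3 : |t - u| ^ γ ≤ (t - s) ^ γ := by
      rw [abs_of_nonneg (by linarith)]
      exact Real.rpow_le_rpow (by linarith) (by linarith) hγ0.le
    calc NA * |t - u| ^ γ * ‖θ x s - θ x u‖ ^ ν
        ≤ NA * (t - s) ^ γ * (K ^ ν * (t - s) ^ (ν * ρ)) := by gcongr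
      _ = M * (t - s) ^ β := by
        rw [hβdef, Real.rpow_add_of_nonneg hts hγ0.le (by positivity), hMdef]; ring
  have hΞ0 : ∀ x u, Ξ x u u = 0 := fun x u => by simp [hΞ]
  have hsew : ∀ x, ∃ Φ : ℝ → (Fin d → ℝ) →L[ℝ] (Fin d → ℝ), x ∈ Set.Icc (0:ℝ) 1 →
      (∀ t ∈ Set.Icc 0 T, Filter.Tendsto (fun n => dySum (Ξ x) T n t) Filter.atTop
        (nhds (Φ t))) ∧ Φ 0 = 0 ∧
      ∀ s t, 0 ≤ s → s ≤ t → t ≤ T → ‖Φ t - Φ s - Ξ x s t‖ ≤ Cβ * M * (t - s) ^ β := by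
    intro x
    by_cases hx : x ∈ Set.Icc (0:ℝ) 1
    · obtain ⟨Φ, h⟩ := sewing (Ξ x) M β Cβ T hT hsum hM hCβ (hΞ0 x) (hδ x hx)
      exact ⟨Φ, fun _ => h⟩
    · exact ⟨0, fun h => absurd h hx⟩
  choose J hJ using hsew
  -- increments of J
  have hinc : ∀ x ∈ Set.Icc (0:ℝ) 1, ∀ s t, 0 ≤ s → s ≤ t → t ≤ T →
      ‖J x t - J x s‖ ≤ (1 + Cβ * T ^ (ν * ρ)) * NA * (1 + K₁ + K₂) * (t - s) ^ γ := by
    intro x hx s t hs hst htT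
    have h1 := (hJ x hx).2.2 s t hs hst htT
    have h2 : ‖Ξ x s t‖ ≤ NA * (t - s) ^ γ := by
      have := (hT1 s ⟨hs, by linarith⟩ t ⟨by linarith, htT⟩ (θ x s)).2
      rwa [abs_of_nonneg (by linarith)] at this
    have h3 : ‖J x t - J x s‖ ≤ ‖J x t - J x s - Ξ x s t‖ + ‖Ξ x s t‖ := by
      simpa using norm_add_le (J x t - J x s - Ξ x s t) (Ξ x s t)
    have hts : 0 ≤ t - s := by linarith
    have h4 : (t - s) ^ β ≤ T ^ (ν * ρ) * (t - s) ^ γ := by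
      rw [hβdef, Real.rpow_add_of_nonneg hts hγ0.le (by positivity), mul_comm]
      exact mul_le_mul_of_nonneg_right
        (Real.rpow_le_rpow hts (by linarith) (by positivity)) (by positivity)
    have h5 : K ^ ν ≤ 1 + K := by
      rcases le_total K 1 with h | h
      · exact (Real.rpow_le_one hK0 h hν0.le).trans (by linarith)
      · exact (Real.rpow_le_rpow_of_exponent_le h hν1).trans (by rw [Real.rpow_one]; linarith)
    have h6 : Cβ * M * (t - s) ^ β ≤ Cβ * (NA * (1 + K)) * (T ^ (ν * ρ) * (t - s) ^ γ) := by
      rw [hMdef]; gcongr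
    have h7 : NA * (t - s) ^ γ ≤ NA * (1 + K) * (t - s) ^ γ := by
      have : NA ≤ NA * (1 + K) := le_mul_of_one_le_right hNA (by linarith)
      gcongr
    calc _ ≤ _ := h3
      _ ≤ Cβ * (NA * (1 + K)) * (T ^ (ν * ρ) * (t - s) ^ γ) + NA * (1 + K) * (t - s) ^ γ := by
        linarith
      _ = _ := by rw [hK]; ring
  -- continuity in space
  have hDAc : ∀ t ∈ Set.Icc 0 T, Continuous (DA t) := by
    intro t ht
    rw [continuous_iff_continuousAt]
    intro x
    rw [ContinuousAt, tendsto_iff_norm_sub_tendsto_zero]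
    refine squeeze_zero (fun _ => norm_nonneg _) (fun y => hH t ht y x) ?_
    have : ContinuousAt (fun y => NA * ‖y - x‖ ^ ν) x := by
      refine ContinuousAt.const_mul ?_ NA
      exact ContinuousAt.rpow_const (by fun_prop) (Or.inr hν0.le)
    have h := this.tendsto
    simpa [Real.zero_rpow hν0.ne'] using h
  have hθc : ∀ s, Continuous (fun x => θ x s) := by
    intro s; simp only [hθdef]; fun_prop
  have hΞc : ∀ s ∈ Set.Icc 0 T, ∀ t ∈ Set.Icc 0 T, Continuous (fun x => Ξ x s t) := by
    intro s hs t ht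
    exact ((hDAc t ht).comp (hθc s)).sub ((hDAc s hs).comp (hθc s))
  -- integrability
  have hJint : ∀ t ∈ Set.Icc 0 T, MeasureTheory.IntegrableOn (fun x => J x t) (Set.Icc 0 1)
      MeasureTheory.volume := by
    intro t ht
    refine MeasureTheory.Integrable.of_bound (μ := MeasureTheory.volume.restrict (Set.Icc (0:ℝ) 1))
      ?_ ((1 + Cβ * T ^ (ν * ρ)) * NA * (1 + K₁ + K₂) * (t - 0) ^ γ) ?_
    · refine aestronglyMeasurable_of_tendsto_ae Filter.atTop
        (f := fun n x => dySum (Ξ x) T n t) ?_ ?_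
      · intro n
        refine Continuous.aestronglyMeasurable ?_
        unfold dySum
        refine continuous_finsetSum _ fun k _ => hΞc _ ?_ _ ?_
        · exact ⟨le_min (by positivity) ht.1, (min_le_right _ _).trans ht.2⟩
        · exact ⟨le_min (by positivity) ht.1, (min_le_right _ _).trans ht.2⟩
      · filter_upwards [MeasureTheory.ae_restrict_mem measurableSet_Icc] with x hx
        exact (hJ x hx).1 t ht
    · filter_upwards [MeasureTheory.ae_restrict_mem measurableSet_Icc] with x hx
      have := hinc x hx 0 t le_rfl ht.1 ht.2
      rwa [(hJ x hx).2.1, sub_zero] at this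
  have hΞint : ∀ s ∈ Set.Icc 0 T, ∀ t ∈ Set.Icc 0 T,
      MeasureTheory.IntegrableOn (fun x => Ξ x s t) (Set.Icc 0 1) MeasureTheory.volume :=
    fun s hs t ht => (hΞc s hs t ht).continuousOn.integrableOn_Icc
  have hvol : (MeasureTheory.volume : MeasureTheory.Measure ℝ).real (Set.Icc (0:ℝ) 1) = 1 := by
    simp [MeasureTheory.Measure.real]
  set V : ℝ → (Fin d → ℝ) →L[ℝ] (Fin d → ℝ) := fun t => ∫ x in Set.Icc (0:ℝ) 1, J x t with hV
  have hVinc : ∀ s t, 0 ≤ s → s ≤ t → t ≤ T →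
      ‖V t - V s‖ ≤ (1 + Cβ * T ^ (ν * ρ)) * NA * (1 + K₁ + K₂) * (t - s) ^ γ := by
    intro s t hs hst htT
    simp only [hV]
    rw [← MeasureTheory.integral_sub (hJint t ⟨by linarith, htT⟩) (hJint s ⟨hs, by linarith⟩)]
    have := MeasureTheory.norm_setIntegral_le_of_norm_le_const
      (μ := MeasureTheory.volume) (s := Set.Icc (0:ℝ) 1) (f := fun x => J x t - J x s)
      (by simp) (fun x hx => hinc x hx s t hs hst htT)
    rwa [hvol, mul_one] at this
  -- the key comparison
  have hΞV : ∀ s t, 0 ≤ s → s ≤ t → t ≤ T →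
      ‖V t - V s - ∫ x in Set.Icc (0:ℝ) 1, Ξ x s t‖ ≤ Cβ * M * (t - s) ^ β := by
    intro s t hs hst htT
    have hsI : s ∈ Set.Icc 0 T := ⟨hs, by linarith⟩
    have htI : t ∈ Set.Icc 0 T := ⟨by linarith, htT⟩
    simp only [hV]
    rw [← MeasureTheory.integral_sub (hJint t htI) (hJint s hsI),
      ← MeasureTheory.integral_sub (f := fun x => J x t - J x s)
        ((hJint t htI).sub (hJint s hsI)) (hΞint s hsI t htI)]
    have := MeasureTheory.norm_setIntegral_le_of_norm_le_const
      (μ := MeasureTheory.volume) (s := Set.Icc (0:ℝ) 1) (f := fun x => J x t - J x s - Ξ x s t)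
      (by simp) (fun x hx => (hJ x hx).2.2 s t hs hst htT)
    rwa [hvol, mul_one] at this
  have hFTC : ∀ s ∈ Set.Icc 0 T, ∀ t ∈ Set.Icc 0 T,
      (∫ x in Set.Icc (0:ℝ) 1, Ξ x s t) (θ1 s - θ2 s) =
        (A t (θ1 s) - A s (θ1 s)) - (A t (θ2 s) - A s (θ2 s)) := by
    intro s hs t ht
    rw [ContinuousLinearMap.integral_apply (hΞint s hs t ht),
      MeasureTheory.integral_Icc_eq_integral_Ioc, ← intervalIntegral.integral_of_le zero_le_one]
    have hd : ∀ x ∈ Set.uIcc (0:ℝ) 1,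
        HasDerivAt (fun x => A t (θ x s) - A s (θ x s)) (Ξ x s t (θ1 s - θ2 s)) x := by
      intro x _
      have h1 : HasDerivAt (fun x => θ x s) (θ1 s - θ2 s) x := by
        simp only [hθdef]
        simpa using ((hasDerivAt_id x).smul_const (θ1 s - θ2 s)).const_add (θ2 s)
      have h2 := (hD t (θ x s)).comp_hasDerivAt x h1
      have h3 := (hD s (θ x s)).comp_hasDerivAt x h1
      exact h2.sub h3
    rw [intervalIntegral.integral_eq_sub_of_hasDerivAt hd]
    · simp [hθdef]
    · exact ((hΞc s hs t ht).clm_apply continuous_const).intervalIntegrable _ _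
  refine ⟨V, J, ?_, fun t _ => rfl, ?_, ?_⟩
  · intro x hx t ht ε hε
    obtain ⟨δ, hδ0, hsm⟩ := part_small β (Cβ * M) T hsum (by positivity) hT ε hε
    refine ⟨δ, hδ0, fun n τ hp hm => ?_⟩
    have htel : J x t = ∑ i : Fin n, (J x (τ i.succ) - J x (τ i.castSucc)) := by
      rw [sum_tele τ (J x), hp.2.1, hp.2.2, (hJ x hx).2.1, sub_zero]
    rw [htel, ← Finset.sum_sub_distrib]
    refine (norm_sum_le_of_le _ fun i _ => ?_).trans (hsm t ht n τ hp hm)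
    rw [norm_sub_rev]
    exact (hJ x hx).2.2 _ _ (part_mem ht hp _).1 (hp.1 (Fin.castSucc_lt_succ).le)
      (part_mem ht hp _).2
  · intro s hs t ht
    rcases le_total s t with h | h
    · rw [abs_of_nonneg (by linarith)]
      exact hVinc s t hs.1 h ht.2
    · rw [abs_sub_comm, abs_of_nonneg (by linarith), norm_sub_rev]
      exact hVinc t s ht.1 h hs.2
  · intro t ht ε hε
    -- bound for θ1 - θ2
    set Y := ‖θ1 0 - θ2 0‖ + (K₁ * T ^ ρ + K₂ * T ^ ρ) with hY
    have hY0 : 0 ≤ Y := by positivity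
    have hYb : ∀ s ∈ Set.Icc 0 T, ‖θ1 s - θ2 s‖ ≤ Y := by
      intro s hs
      have e : θ1 s - θ2 s = (θ1 0 - θ2 0) + ((θ1 s - θ1 0) - (θ2 s - θ2 0)) := by abel
      rw [e]
      refine (norm_add_le _ _).trans (add_le_add_right ((norm_sub_le _ _).trans ?_) _)
      have hss : |s - 0| ^ ρ ≤ T ^ ρ := by
        rw [sub_zero, abs_of_nonneg hs.1]
        exact Real.rpow_le_rpow hs.1 hs.2 hρ0.le
      exact add_le_add ((hθ1 0 h0T s hs).trans (mul_le_mul_of_nonneg_left hss hK1))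
        ((hθ2 0 h0T s hs).trans (mul_le_mul_of_nonneg_left hss hK2))
    obtain ⟨δ, hδ0, hsm⟩ := part_small β (Cβ * M * Y) T hsum (by positivity) hT (ε / 3)
      (by positivity)
    obtain ⟨δ1, hδ1, h1⟩ := hI1 t ht (ε / 3) (by positivity)
    obtain ⟨δ2, hδ2, h2⟩ := hI2 t ht (ε / 3) (by positivity)
    refine ⟨min δ (min δ1 δ2), by positivity, fun n τ hp hm => ?_⟩
    have s0 := hsm t ht n τ hp fun i => (hm i).trans (min_le_left _ _)
    have s1 := h1 n τ hp fun i => (hm i).trans ((min_le_right _ _).trans (min_le_left _ _))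
    have s2 := h2 n τ hp fun i => (hm i).trans ((min_le_right _ _).trans (min_le_right _ _))
    set S1 := ∑ i : Fin n,
      (A (τ i.succ) (θ1 (τ i.castSucc)) - A (τ i.castSucc) (θ1 (τ i.castSucc))) with hS1
    set S2 := ∑ i : Fin n,
      (A (τ i.succ) (θ2 (τ i.castSucc)) - A (τ i.castSucc) (θ2 (τ i.castSucc))) with hS2
    have s3 : ‖∑ i : Fin n, (V (τ i.succ) - V (τ i.castSucc))
        (θ1 (τ i.castSucc) - θ2 (τ i.castSucc)) - (S1 - S2)‖ ≤ ε / 3 := by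
      rw [hS1, hS2, ← Finset.sum_sub_distrib, ← Finset.sum_sub_distrib]
      refine (norm_sum_le_of_le _ fun i _ => ?_).trans s0
      have ma := part_mem ht hp i.castSucc
      have mb := part_mem ht hp i.succ
      have hle : τ i.castSucc ≤ τ i.succ := hp.1 (Fin.castSucc_lt_succ).le
      rw [← hFTC _ ma _ mb, ← sub_apply]
      refine (ContinuousLinearMap.le_opNorm _ _).trans ?_
      have b1 := hΞV _ _ ma.1 hle mb.2
      have b2 := hYb _ ma
      calc _ ≤ Cβ * M * (τ i.succ - τ i.castSucc) ^ β * Y :=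
            mul_le_mul b1 b2 (norm_nonneg _) ((norm_nonneg _).trans b1)
        _ = _ := by ring
    set S := ∑ i : Fin n, (V (τ i.succ) - V (τ i.castSucc))
        (θ1 (τ i.castSucc) - θ2 (τ i.castSucc))
    calc ‖S - (I1 t - I2 t)‖ = ‖(S - (S1 - S2)) + ((S1 - I1 t) - (S2 - I2 t))‖ := by
          congr 1; abel
      _ ≤ ‖S - (S1 - S2)‖ + (‖S1 - I1 t‖ + ‖S2 - I2 t‖) :=
          (norm_add_le _ _).trans (add_le_add_right (norm_sub_le _ _) _)
      _ ≤ ε := by linarith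
end

section
/- Let E be a Banach space and X : [0,T] → E a continuous stochastic process such that E[exp(λ ‖X_t − X_s‖²_E / |t−s|^{2α})] ≤ C for all s ≠ t, for some λ, C > 0 and α ∈ (0,1). Then almost surely X has modulus of continuity ω(r) = r^α √(−log r), and there exists β > 0 with E[exp(β [X]²_{C^ω E})] < ∞. In particular if X_0 ≡ 0, then for every γ < α there is β > 0 with E[exp(β ‖X‖²_{C^γ E})] < ∞. -/
open MeasureTheory

lemma chain_floor {E : Type*} [NormedAddCommGroup E] (T : ℝ) (hT : 0 < T) (f : ℝ → E)
    (hf : ContinuousOn f (Set.Icc 0 T)) (n : ℕ) (b : ℕ → ℝ) (hb0 : ∀ j, 0 ≤ b j)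
    (hbs : Summable b)
    (hb : ∀ j k : ℕ, k < 2 ^ (n + j) →
      ‖f (T * ((k + 1 : ℕ) : ℝ) / 2 ^ (n + j)) - f (T * (k : ℝ) / 2 ^ (n + j))‖ ≤ b j)
    (t : ℝ) (ht : t ∈ Set.Icc 0 T) :
    ‖f t - f (T * (⌊t / T * 2 ^ n⌋₊ : ℝ) / 2 ^ n)‖ ≤ ∑' j, b (j + 1) := by
  set x := t / T with hx
  have hx0 : 0 ≤ x := div_nonneg ht.1 hT.le
  have hx1 : x ≤ 1 := (div_le_one hT).2 ht.2
  set p : ℕ → ℝ := fun j => T * (⌊x * 2 ^ (n + j)⌋₊ : ℝ) / 2 ^ (n + j) with hp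
  have hstep : ∀ j, ‖f (p (j + 1)) - f (p j)‖ ≤ b (j + 1) := by
    intro j
    set k := ⌊x * 2 ^ (n + j)⌋₊ with hk
    set k' := ⌊x * 2 ^ (n + (j + 1))⌋₊ with hk'
    have hy0 : 0 ≤ x * 2 ^ (n + j) := by positivity
    have hy0' : 0 ≤ x * 2 ^ (n + (j + 1)) := by positivity
    have h1 : (k : ℝ) ≤ x * 2 ^ (n + j) := Nat.floor_le hy0
    have h2 : x * 2 ^ (n + j) < k + 1 := Nat.lt_floor_add_one _
    have h3 : (k' : ℝ) ≤ x * 2 ^ (n + (j + 1)) := Nat.floor_le hy0'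
    have h4 : x * 2 ^ (n + (j + 1)) < k' + 1 := Nat.lt_floor_add_one _
    have e : x * 2 ^ (n + (j + 1)) = 2 * (x * 2 ^ (n + j)) := by
      rw [← add_assoc, pow_succ]; ring
    have h5 : 2 * k < k' + 1 := by
      have : (2 * k : ℝ) < k' + 1 := by linarith
      exact_mod_cast this
    have h6 : k' < 2 * k + 2 := by
      have : (k' : ℝ) < 2 * k + 2 := by linarith
      exact_mod_cast this
    have h7 : k' ≤ 2 ^ (n + (j + 1)) := by
      have h2p : (0:ℝ) < 2 ^ (n + (j + 1)) := by positivity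
      have : (k' : ℝ) ≤ 2 ^ (n + (j + 1)) := by nlinarith
      exact_mod_cast this
    have hpj : p j = T * ((2 * k : ℕ) : ℝ) / 2 ^ (n + (j + 1)) := by
      simp only [hp]
      rw [← hk, ← add_assoc, pow_succ]
      push_cast
      field_simp
    have hpj' : p (j + 1) = T * (k' : ℝ) / 2 ^ (n + (j + 1)) := rfl
    rcases (by omega : k' = 2 * k ∨ k' = 2 * k + 1) with h | h
    · rw [hpj, hpj', h]; simpa using hb0 _
    · rw [hpj, hpj', h]
      exact hb (j + 1) (2 * k) (by omega)
  have hbs' : Summable fun j => b (j + 1) := (summable_nat_add_iff 1).2 hbs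
  have hsum : ∀ J, ‖f (p J) - f (p 0)‖ ≤ ∑' j, b (j + 1) := by
    intro J
    have : ‖f (p J) - f (p 0)‖ ≤ ∑ j ∈ Finset.range J, b (j + 1) := by
      rw [← Finset.sum_range_sub (fun j => f (p j))]
      exact (norm_sum_le _ _).trans (Finset.sum_le_sum fun j _ => hstep j)
    exact this.trans (hbs'.sum_le_tsum _ fun j _ => hb0 _)
  have hpm : ∀ j, p j ∈ Set.Icc 0 T := by
    intro j
    refine ⟨by positivity, ?_⟩
    simp only [hp]
    have h1 : (⌊x * 2 ^ (n + j)⌋₊ : ℝ) ≤ x * 2 ^ (n + j) := Nat.floor_le (by positivity)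
    have h2p : (0:ℝ) < 2 ^ (n + j) := by positivity
    rw [div_le_iff₀ h2p]
    have : (⌊x * 2 ^ (n + j)⌋₊ : ℝ) ≤ 2 ^ (n + j) := by nlinarith
    gcongr
  have hpt : Filter.Tendsto p Filter.atTop (nhds t) := by
    have hle : ∀ j, |p j - t| ≤ T * (1 / 2) ^ j := by
      intro j
      have h1 : (⌊x * 2 ^ (n + j)⌋₊ : ℝ) ≤ x * 2 ^ (n + j) := Nat.floor_le (by positivity)
      have h2 : x * 2 ^ (n + j) < (⌊x * 2 ^ (n + j)⌋₊ : ℝ) + 1 := Nat.lt_floor_add_one _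
      have h2p : (0:ℝ) < 2 ^ (n + j) := by positivity
      have htx : t = T * (x * 2 ^ (n + j)) / 2 ^ (n + j) := by
        rw [hx]; field_simp
      have : p j - t = T * ((⌊x * 2 ^ (n + j)⌋₊ : ℝ) - x * 2 ^ (n + j)) / 2 ^ (n + j) := by
        conv_lhs => rw [htx]
        simp only [hp]; ring
      rw [this, abs_div, abs_mul, abs_of_pos hT, abs_of_pos h2p, div_le_iff₀ h2p]
      have h3 : |(⌊x * 2 ^ (n + j)⌋₊ : ℝ) - x * 2 ^ (n + j)| ≤ 1 := by
        rw [abs_le]; constructor <;> linarith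
      have h4 : (1:ℝ) ≤ (1 / 2) ^ j * 2 ^ (n + j) := by
        rw [pow_add, mul_comm ((2:ℝ) ^ n), ← mul_assoc, ← mul_pow]
        norm_num
        exact one_le_pow₀ (by norm_num)
      rw [mul_assoc]
      exact mul_le_mul_of_nonneg_left (h3.trans h4) hT.le
    have h0 : Filter.Tendsto (fun j : ℕ => T * (1 / 2 : ℝ) ^ j) Filter.atTop (nhds 0) := by
      simpa using (tendsto_pow_atTop_nhds_zero_of_lt_one (by norm_num : (0:ℝ) ≤ 1 / 2)
        (by norm_num)).const_mul T
    have h1 : Filter.Tendsto (fun j => p j - t) Filter.atTop (nhds 0) :=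
      squeeze_zero_norm hle h0
    simpa using h1.add_const t
  have hft : Filter.Tendsto (fun j => f (p j)) Filter.atTop (nhds (f t)) :=
    (hf t ht).tendsto.comp (tendsto_nhdsWithin_iff.2 ⟨hpt, Filter.Eventually.of_forall hpm⟩)
  exact le_of_tendsto (hft.sub_const _).norm (Filter.Eventually.of_forall hsum)

lemma chain_two {E : Type*} [NormedAddCommGroup E] (T : ℝ) (hT : 0 < T) (f : ℝ → E)
    (hf : ContinuousOn f (Set.Icc 0 T)) (n : ℕ) (b : ℕ → ℝ) (hb0 : ∀ j, 0 ≤ b j)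
    (hbs : Summable b)
    (hb : ∀ j k : ℕ, k < 2 ^ (n + j) →
      ‖f (T * ((k + 1 : ℕ) : ℝ) / 2 ^ (n + j)) - f (T * (k : ℝ) / 2 ^ (n + j))‖ ≤ b j)
    (s t : ℝ) (hs : s ∈ Set.Icc 0 T) (ht : t ∈ Set.Icc 0 T) (hst : s ≤ t)
    (hr : (t - s) * 2 ^ n ≤ T) :
    ‖f t - f s‖ ≤ 2 * ∑' j, b j := by
  have h1 := chain_floor T hT f hf n b hb0 hbs hb t ht
  have h2 := chain_floor T hT f hf n b hb0 hbs hb s hs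
  set k := ⌊s / T * 2 ^ n⌋₊ with hk
  set k' := ⌊t / T * 2 ^ n⌋₊ with hk'
  have hs0 : 0 ≤ s / T * 2 ^ n := mul_nonneg (div_nonneg hs.1 hT.le) (by positivity)
  have ht0 : 0 ≤ t / T * 2 ^ n := mul_nonneg (div_nonneg ht.1 hT.le) (by positivity)
  have hkk : k ≤ k' := Nat.floor_mono (by gcongr)
  have a2 : s / T * 2 ^ n < k + 1 := Nat.lt_floor_add_one _
  have a3 : (k' : ℝ) ≤ t / T * 2 ^ n := Nat.floor_le ht0
  have a4 : t / T * 2 ^ n ≤ s / T * 2 ^ n + 1 := by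
    have : (t - s) * 2 ^ n / T ≤ 1 := (div_le_one hT).2 hr
    have e : (t - s) * 2 ^ n / T = t / T * 2 ^ n - s / T * 2 ^ n := by ring
    linarith
  have hk2 : k' < k + 2 := by
    have : (k' : ℝ) < k + 2 := by linarith
    exact_mod_cast this
  have hk3 : k' ≤ 2 ^ n := by
    have h2p : (0:ℝ) < 2 ^ n := by positivity
    have : t / T ≤ 1 := (div_le_one hT).2 ht.2
    have : (k' : ℝ) ≤ 2 ^ n := by nlinarith
    exact_mod_cast this
  have hmid : ‖f (T * (k' : ℝ) / 2 ^ n) - f (T * (k : ℝ) / 2 ^ n)‖ ≤ b 0 := by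
    rcases (by omega : k' = k ∨ k' = k + 1) with h | h
    · rw [h]; simpa using hb0 0
    · rw [h]; exact hb 0 k (by simp; omega)
  have hsum : ∑' j, b j = b 0 + ∑' j, b (j + 1) := hbs.tsum_eq_zero_add
  have e : f t - f s = (f t - f (T * (k' : ℝ) / 2 ^ n)) +
      (f (T * (k' : ℝ) / 2 ^ n) - f (T * (k : ℝ) / 2 ^ n)) -
      (f s - f (T * (k : ℝ) / 2 ^ n)) := by abel
  have h3 := norm_sub_le ((f t - f (T * (k' : ℝ) / 2 ^ n)) +
      (f (T * (k' : ℝ) / 2 ^ n) - f (T * (k : ℝ) / 2 ^ n))) (f s - f (T * (k : ℝ) / 2 ^ n))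
  have h4 := norm_add_le (f t - f (T * (k' : ℝ) / 2 ^ n))
      (f (T * (k' : ℝ) / 2 ^ n) - f (T * (k : ℝ) / 2 ^ n))
  rw [← e] at h3
  have := hb0 0
  linarith

lemma summable_aux (q : ℝ) (h0 : 0 ≤ q) (h1 : q < 1) :
    Summable fun j : ℕ => ((j : ℝ) + 1) * q ^ j := by
  have a := summable_pow_mul_geometric_of_norm_lt_one 1 (r := q)
    (by rwa [Real.norm_of_nonneg h0])
  have b := summable_geometric_of_lt_one h0 h1
  refine (a.add b).congr fun j => by ring

lemma det_bound (T : ℝ) (hT : 0 < T) (α : ℝ) (hα : α ∈ Set.Ioo (0:ℝ) 1) (lam : ℝ)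
    (hlam : 0 < lam) : ∃ K > (0:ℝ), ∀ {E : Type*} [NormedAddCommGroup E] (f : ℝ → E)
    (_ : ContinuousOn f (Set.Icc 0 T)) (M : ℝ) (_ : 1 ≤ M)
    (_ : ∀ m k : ℕ, k < 2 ^ m →
      Real.exp (lam * ‖f (T * ((k + 1 : ℕ) : ℝ) / 2 ^ m) - f (T * (k : ℝ) / 2 ^ m)‖ ^ 2 /
        (T / 2 ^ m) ^ (2 * α)) ≤ 4 ^ m * M)
    (s t : ℝ) (_ : s ∈ Set.Icc 0 T) (_ : t ∈ Set.Icc 0 T) (_ : s ≠ t),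
    ∃ n : ℕ, |t - s| * 2 ^ n ≤ T ∧
      ‖f t - f s‖ ^ 2 ≤ K * (n + 1) * (2 + Real.log M) * |t - s| ^ (2 * α) := by
  obtain ⟨hα0, hα1⟩ := hα
  set q : ℝ := (1 / 2 : ℝ) ^ α with hq
  have hq0 : 0 < q := by positivity
  have hq1 : q < 1 := Real.rpow_lt_one (by norm_num) (by norm_num) hα0
  have hS := summable_aux q hq0.le hq1
  set S := ∑' j : ℕ, ((j : ℝ) + 1) * q ^ j with hSdef
  have hS0 : 0 < S := hS.tsum_pos (fun j => by positivity) 0 (by simp)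
  refine ⟨16 * S ^ 2 / lam, by positivity, ?_⟩
  intro E _ f hf M hM hexp s t hs ht hne
  wlog hst : s < t generalizing s t
  · have := this t s ht hs hne.symm (lt_of_le_of_ne (not_lt.1 hst) hne.symm)
    rwa [abs_sub_comm, norm_sub_rev]
  have hr0 : 0 < t - s := by linarith
  rw [abs_of_pos hr0]
  have hrT : t - s ≤ T := by linarith [hs.1, ht.2]
  obtain ⟨n, hn1, hn2⟩ := exists_nat_pow_near ((one_le_div hr0).2 hrT) (one_lt_two)
  rw [le_div_iff₀ hr0] at hn1
  rw [div_lt_iff₀ hr0] at hn2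
  refine ⟨n, by linarith, ?_⟩
  set L := Real.log M with hL
  have hL0 : 0 ≤ L := Real.log_nonneg hM
  set B := Real.sqrt ((T / 2 ^ n) ^ (2 * α) / lam * (n + 1) * (2 + L)) with hB
  have hB2 : B ^ 2 = (T / 2 ^ n) ^ (2 * α) / lam * (n + 1) * (2 + L) :=
    Real.sq_sqrt (by positivity)
  have hB0 : 0 ≤ B := Real.sqrt_nonneg _
  have key := chain_two T hT f hf n (fun j => B * (((j : ℝ) + 1) * q ^ j))
    (fun j => by positivity) (hS.mul_left B) ?_ s t hs ht hst.le (by linarith)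
  · rw [tsum_mul_left, ← hSdef] at key
    have h1 : ‖f t - f s‖ ^ 2 ≤ (2 * (B * S)) ^ 2 := by gcongr
    have h2 : (T / 2 ^ n) ^ (2 * α) ≤ 4 * (t - s) ^ (2 * α) := by
      have : T / 2 ^ n ≤ 2 * (t - s) := by
        rw [div_le_iff₀ (by positivity)]
        rw [pow_succ] at hn2; nlinarith
      calc (T / 2 ^ n) ^ (2 * α) ≤ (2 * (t - s)) ^ (2 * α) :=
            Real.rpow_le_rpow (by positivity) this (by positivity)
        _ = 2 ^ (2 * α) * (t - s) ^ (2 * α) := Real.mul_rpow (by norm_num) hr0.le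
        _ ≤ 4 * (t - s) ^ (2 * α) := by
            have : (2:ℝ) ^ (2 * α) ≤ 2 ^ (2:ℝ) :=
              Real.rpow_le_rpow_of_exponent_le (by norm_num) (by linarith)
            have e : (2:ℝ) ^ (2:ℝ) = 4 := by norm_num
            rw [e] at this
            gcongr
    calc ‖f t - f s‖ ^ 2 ≤ (2 * (B * S)) ^ 2 := h1
      _ = 4 * S ^ 2 / lam * (n + 1) * (2 + L) * (T / 2 ^ n) ^ (2 * α) := by
          rw [mul_pow, mul_pow, hB2]; ring
      _ ≤ 4 * S ^ 2 / lam * (n + 1) * (2 + L) * (4 * (t - s) ^ (2 * α)) := by gcongr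
      _ = _ := by ring
  · intro j k hk
    have h := hexp (n + j) k hk
    set D := ‖f (T * ((k + 1 : ℕ) : ℝ) / 2 ^ (n + j)) - f (T * (k : ℝ) / 2 ^ (n + j))‖ with hD
    have hM0 : 0 < M := by linarith
    rw [← Real.le_log_iff_exp_le (by positivity), Real.log_mul (by positivity) (by positivity),
      Real.log_pow, ← hL, div_le_iff₀ (by positivity)] at h
    have e1 : (T / 2 ^ (n + j)) ^ (2 * α) = (T / 2 ^ n) ^ (2 * α) * (q ^ j) ^ 2 := by
      have : T / 2 ^ (n + j) = T / 2 ^ n * (1 / 2) ^ j := by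
        rw [pow_add, div_pow, one_pow]; field_simp
      rw [this, Real.mul_rpow (by positivity) (by positivity), hq]
      congr 1
      rw [← Real.rpow_natCast, ← Real.rpow_natCast, ← Real.rpow_natCast, ← Real.rpow_mul (by positivity),
        ← Real.rpow_mul (by positivity), ← Real.rpow_mul (by positivity)]
      congr 1; push_cast; ring
    have hlog4 : Real.log 4 ≤ 2 := by
      have : Real.log 4 = 2 * Real.log 2 := by
        rw [show (4:ℝ) = 2 ^ 2 by norm_num, Real.log_pow]; norm_num
      have := Real.log_two_lt_d9
      linarith
    have h2 : ((n + j : ℕ) : ℝ) * Real.log 4 + L ≤ (n + 1) * (2 + L) * ((j:ℝ) + 1) ^ 2 := by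
      push_cast
      have a : ((n:ℝ) + j) * Real.log 4 ≤ (n + j) * 2 := by gcongr
      have hn0 : (0:ℝ) ≤ n := by positivity
      have hj0 : (0:ℝ) ≤ j := by positivity
      have b : (n:ℝ) + j + 1 ≤ (n + 1) * (j + 1) ^ 2 := by
        nlinarith [mul_nonneg hn0 hj0, mul_nonneg hn0 (mul_nonneg hj0 hj0), mul_nonneg hj0 hj0]
      calc ((n:ℝ) + j) * Real.log 4 + L ≤ (n + j + 1) * (2 + L) := by nlinarith
        _ ≤ ((n + 1) * (j + 1) ^ 2) * (2 + L) := by gcongr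
        _ = _ := by ring
    refine le_of_sq_le_sq ?_ (by positivity)
    rw [mul_pow, hB2, mul_pow]
    rw [e1] at h
    have h3 : lam * D ^ 2 ≤ ((n + 1) * (2 + L) * ((j:ℝ) + 1) ^ 2) *
        ((T / 2 ^ n) ^ (2 * α) * (q ^ j) ^ 2) := h.trans (by gcongr)
    rw [mul_comm, ← le_div_iff₀ hlam] at h3
    exact h3.trans (le_of_eq (by ring))

lemma le_of_exp_aux (x c β M : ℝ) (hc : 0 < c) (hM : 1 ≤ M) (hβ0 : 0 ≤ β) (hβ : β * c ≤ 1)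
    (hx : x ≤ c * (2 + Real.log M)) : Real.exp (β * x) ≤ Real.exp 2 * M := by
  have hL0 : 0 ≤ Real.log M := Real.log_nonneg hM
  calc Real.exp (β * x) ≤ Real.exp (2 + Real.log M) := by
        apply Real.exp_le_exp.2
        calc β * x ≤ β * (c * (2 + Real.log M)) := by gcongr
          _ = (β * c) * (2 + Real.log M) := by ring
          _ ≤ 1 * (2 + Real.log M) := by gcongr
          _ = _ := one_mul _
    _ = _ := by rw [Real.exp_add, Real.exp_log (by linarith)]

lemma prob_bound {Ω : Type*} [MeasurableSpace Ω] (μ : Measure Ω) (C : ℝ)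
    (Y : ℕ → ℕ → Ω → ℝ) (hY : ∀ m k, k < 2 ^ m → AEMeasurable (Y m k) μ)
    (hY1 : ∀ m k ω, 1 ≤ Y m k ω)
    (hint : ∀ m k, k < 2 ^ m → ∫⁻ ω, ENNReal.ofReal (Y m k ω) ∂μ ≤ ENNReal.ofReal C) :
    ∃ M : Ω → ℝ, Integrable M μ ∧ ∀ᵐ ω ∂μ, 1 ≤ M ω ∧
      ∀ m k : ℕ, k < 2 ^ m → Y m k ω ≤ 4 ^ m * M ω := by
  set W : Ω → ENNReal := fun ω => ∑' m : ℕ, ∑ k ∈ Finset.range (2 ^ m),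
    ENNReal.ofReal ((1 / 4) ^ m) * ENNReal.ofReal (Y m k ω) with hW
  have hm1 : ∀ m k, k < 2 ^ m → AEMeasurable (fun ω => ENNReal.ofReal ((1 / 4) ^ m) *
      ENNReal.ofReal (Y m k ω)) μ := fun m k hk => ((hY m k hk).ennreal_ofReal).const_mul _
  have hm2 : ∀ m : ℕ, AEMeasurable (fun ω => ∑ k ∈ Finset.range (2 ^ m),
      ENNReal.ofReal ((1 / 4) ^ m) * ENNReal.ofReal (Y m k ω)) μ := fun m =>
    Finset.aemeasurable_fun_sum _ fun k hk => hm1 m k (Finset.mem_range.1 hk)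
  have hWm : AEMeasurable W μ := AEMeasurable.ennreal_tsum hm2
  have hWi : ∫⁻ ω, W ω ∂μ ≠ ⊤ := by
    rw [hW, lintegral_tsum hm2]
    have hle : ∀ m : ℕ, ∫⁻ ω, ∑ k ∈ Finset.range (2 ^ m),
        ENNReal.ofReal ((1 / 4) ^ m) * ENNReal.ofReal (Y m k ω) ∂μ ≤
        ENNReal.ofReal ((1 / 2) ^ m) * ENNReal.ofReal C := by
      intro m
      rw [lintegral_finsetSum' _ fun k hk => hm1 m k (Finset.mem_range.1 hk)]
      calc _ ≤ ∑ k ∈ Finset.range (2 ^ m), ENNReal.ofReal ((1 / 4) ^ m) * ENNReal.ofReal C := by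
            refine Finset.sum_le_sum fun k hk => ?_
            have hk' := Finset.mem_range.1 hk
            rw [lintegral_const_mul'' _ (hY m k hk').ennreal_ofReal]
            gcongr
            exact hint m k hk'
        _ = _ := by
            rw [Finset.sum_const, Finset.card_range, nsmul_eq_mul, ← mul_assoc]
            congr 1
            rw [← ENNReal.ofReal_natCast, ← ENNReal.ofReal_mul (by positivity)]
            congr 1
            push_cast
            rw [← mul_pow]; norm_num
    refine ne_top_of_le_ne_top ?_ (ENNReal.tsum_le_tsum hle)
    rw [ENNReal.tsum_mul_right]
    refine ENNReal.mul_ne_top ?_ ENNReal.ofReal_ne_top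
    rw [← ENNReal.ofReal_tsum_of_nonneg (fun _ => by positivity) summable_geometric_two]
    exact ENNReal.ofReal_ne_top
  refine ⟨fun ω => (W ω).toReal, integrable_toReal_of_lintegral_ne_top hWm hWi, ?_⟩
  filter_upwards [ae_lt_top' hWm hWi] with ω hω
  have hall : ∀ m k : ℕ, k < 2 ^ m → Y m k ω ≤ 4 ^ m * (W ω).toReal := by
    intro m k hk
    have h1 : ENNReal.ofReal ((1 / 4) ^ m) * ENNReal.ofReal (Y m k ω) ≤ W ω :=
      (Finset.single_le_sum (f := fun k => ENNReal.ofReal ((1 / 4) ^ m) *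
        ENNReal.ofReal (Y m k ω)) (fun _ _ => zero_le) (Finset.mem_range.2 hk)).trans
        (ENNReal.le_tsum (f := fun m : ℕ => ∑ k ∈ Finset.range (2 ^ m),
          ENNReal.ofReal ((1 / 4) ^ m) * ENNReal.ofReal (Y m k ω)) m)
    have h0 : 0 ≤ Y m k ω := zero_le_one.trans (hY1 m k ω)
    rw [← ENNReal.ofReal_mul (by positivity), ENNReal.ofReal_le_iff_le_toReal hω.ne] at h1
    calc Y m k ω = 4 ^ m * ((1 / 4) ^ m * Y m k ω) := by
          rw [← mul_assoc, ← mul_pow]; norm_num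
      _ ≤ _ := by gcongr
  refine ⟨?_, hall⟩
  have := hall 0 0 (by norm_num)
  have h1 := hY1 0 0 ω
  simp only [pow_zero, one_mul] at this
  linarith

/-- Chaining lemma with exponential integrability: if a continuous `E`-valued process `X`
satisfies `E[exp(λ ‖X_t - X_s‖²/|t-s|^{2α})] ≤ C` for all `s ≠ t` in `[0,T]`, then almost
surely `X` admits the modulus of continuity `ω(r) = r^α √(-log r)` and for some `β > 0`
the quantity `exp(β [X]²_{C^ω E})` has finite expectation (expressed through an integrable
dominating function `Z`).  If moreover `X_0 ≡ 0`, then for every `γ ∈ (0,α)` there is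
`β > 0` with `E[exp(β ‖X‖²_{C^γ E})] < ∞`. -/
theorem stmt16 {Ω : Type*} [MeasurableSpace Ω] (μ : Measure Ω) [IsProbabilityMeasure μ]
    {E : Type*} [NormedAddCommGroup E] [NormedSpace ℝ E]
    (T : ℝ) (hT : 0 < T) (α : ℝ) (hα : α ∈ Set.Ioo (0:ℝ) 1)
    (X : ℝ → Ω → E)
    (hcont : ∀ ω, ContinuousOn (fun t => X t ω) (Set.Icc 0 T))
    (hmeas : ∀ t, AEStronglyMeasurable (X t) μ)
    (lam C : ℝ) (hlam : 0 < lam) (hC : 0 < C)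
    (hexp : ∀ s ∈ Set.Icc 0 T, ∀ t ∈ Set.Icc 0 T, s ≠ t →
      (∫⁻ ω, ENNReal.ofReal
          (Real.exp (lam * ‖X t ω - X s ω‖ ^ 2 / |t - s| ^ (2 * α))) ∂μ) ≤
        ENNReal.ofReal C) :
    (∃ β > (0:ℝ), ∃ Z : Ω → ℝ, Integrable Z μ ∧
      ∀ᵐ ω ∂μ, ∀ s ∈ Set.Icc 0 T, ∀ t ∈ Set.Icc 0 T,
        0 < |t - s| → |t - s| < 1/2 →
          Real.exp (β * (‖X t ω - X s ω‖ /
            (|t - s| ^ α * Real.sqrt (-Real.log |t - s|))) ^ 2) ≤ Z ω) ∧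
    ((∀ ω, X 0 ω = 0) → ∀ γ ∈ Set.Ioo (0:ℝ) α,
      ∃ β > (0:ℝ), ∃ Z : Ω → ℝ, Integrable Z μ ∧
        ∀ᵐ ω ∂μ, ∀ s ∈ Set.Icc 0 T, ∀ t ∈ Set.Icc 0 T, s ≠ t →
          Real.exp (β * (‖X t ω - X s ω‖ / |t - s| ^ γ) ^ 2) ≤ Z ω ∧
          Real.exp (β * ‖X t ω‖ ^ 2) ≤ Z ω) := by
  obtain ⟨hα0, hα1⟩ := hα
  obtain ⟨K, hK, hdet⟩ := det_bound T hT α ⟨hα0, hα1⟩ lam hlam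
  have hgrid : ∀ m k : ℕ, k ≤ 2 ^ m → T * (k : ℝ) / 2 ^ m ∈ Set.Icc 0 T := by
    intro m k hk
    refine ⟨by positivity, ?_⟩
    have : (k : ℝ) ≤ 2 ^ m := by exact_mod_cast hk
    rw [div_le_iff₀ (by positivity)]
    gcongr
  obtain ⟨M, hMi, hMb⟩ := prob_bound μ C (fun m k ω =>
    Real.exp (lam * ‖X (T * ((k + 1 : ℕ) : ℝ) / 2 ^ m) ω - X (T * (k : ℝ) / 2 ^ m) ω‖ ^ 2 /
        (T / 2 ^ m) ^ (2 * α))) (by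
      intro m k hk
      have h := ((hmeas (T * ((k + 1 : ℕ) : ℝ) / 2 ^ m)).sub
        (hmeas (T * (k : ℝ) / 2 ^ m))).norm.aemeasurable
      exact Real.measurable_exp.comp_aemeasurable (((h.pow_const 2).const_mul lam).div_const _))
    (by
      intro m k ω
      exact Real.one_le_exp (by positivity)) (by
      intro m k hk
      have e : |T * ((k + 1 : ℕ) : ℝ) / 2 ^ m - T * (k : ℝ) / 2 ^ m| = T / 2 ^ m := by
        have : T * ((k + 1 : ℕ) : ℝ) / 2 ^ m - T * (k : ℝ) / 2 ^ m = T / 2 ^ m := by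
          push_cast; ring
        rw [this, abs_of_pos (by positivity)]
      have h := hexp _ (hgrid m k hk.le) _ (hgrid m (k + 1) hk) (by
        intro h
        rw [h, sub_self, abs_zero] at e
        have : 0 < T / 2 ^ m := by positivity
        linarith)
      rwa [e] at h)
  have hZi : Integrable (fun ω => Real.exp 2 * M ω) μ := hMi.const_mul _
  have hmain : ∀ᵐ ω ∂μ, 1 ≤ M ω ∧ ∀ s ∈ Set.Icc 0 T, ∀ t ∈ Set.Icc 0 T, s ≠ t →
      ∃ n : ℕ, |t - s| * 2 ^ n ≤ T ∧
      ‖X t ω - X s ω‖ ^ 2 ≤ K * (n + 1) * (2 + Real.log (M ω)) * |t - s| ^ (2 * α) := by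
    filter_upwards [hMb] with ω hω
    exact ⟨hω.1, fun s hs t ht hst =>
      hdet (fun t => X t ω) (hcont ω) (M ω) hω.1 hω.2 s t hs ht hst⟩
  have hpow2 : ∀ r a : ℝ, 0 ≤ r → (r ^ a) ^ 2 = r ^ (2 * a) := by
    intro r a hr
    rw [← Real.rpow_natCast, ← Real.rpow_mul hr]; congr 1; push_cast; ring
  constructor
  · set l2 := Real.log 2 with hl2
    have hl2p : 0 < l2 := Real.log_pos one_lt_two
    set K' := 1 / l2 + (|Real.log T| / l2 + 1) / l2 with hK'
    have hK'p : 0 < K' := by positivity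
    refine ⟨1 / (K * K'), by positivity, _, hZi, ?_⟩
    filter_upwards [hmain] with ω ⟨hM1, hω⟩
    intro s hs t ht hr0 hr1
    obtain ⟨n, hn, hb⟩ := hω s hs t ht (fun h => by simp [h] at hr0)
    set r := |t - s| with hr
    have hlr : l2 ≤ -Real.log r := by
      rw [hl2, ← Real.log_inv]
      apply Real.log_le_log (by norm_num)
      rw [le_inv_comm₀ (by norm_num) hr0]
      linarith
    have hlr0 : 0 < -Real.log r := by linarith
    have hL0 : 0 ≤ Real.log (M ω) := Real.log_nonneg hM1
    refine le_of_exp_aux _ (K * K') _ _ (by positivity) hM1 (by positivity)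
      (by rw [one_div, inv_mul_cancel₀ (by positivity)]) ?_
    have hn1 : (n : ℝ) + 1 ≤ K' * (-Real.log r) := by
      have h1 := Real.log_le_log (by positivity) hn
      rw [Real.log_mul (by positivity) (by positivity), Real.log_pow, ← hl2] at h1
      have h2 : (n : ℝ) ≤ (|Real.log T| + -Real.log r) / l2 := by
        rw [le_div_iff₀ hl2p]
        linarith [le_abs_self (Real.log T)]
      have h3 : (|Real.log T| / l2 + 1) * 1 ≤ (|Real.log T| / l2 + 1) * (-Real.log r / l2) := by
        gcongr
        rwa [one_le_div hl2p]
      calc (n : ℝ) + 1 ≤ (|Real.log T| + -Real.log r) / l2 + 1 := by linarith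
        _ = (|Real.log T| / l2 + 1) * 1 + -Real.log r / l2 := by ring
        _ ≤ (|Real.log T| / l2 + 1) * (-Real.log r / l2) + -Real.log r / l2 := by linarith
        _ = _ := by rw [hK']; ring
    rw [div_pow, mul_pow, hpow2 r α hr0.le, Real.sq_sqrt hlr0.le, div_le_iff₀ (by positivity)]
    calc ‖X t ω - X s ω‖ ^ 2 ≤ K * (n + 1) * (2 + Real.log (M ω)) * r ^ (2 * α) := hb
      _ ≤ K * (K' * (-Real.log r)) * (2 + Real.log (M ω)) * r ^ (2 * α) := by gcongr
      _ = _ := by ring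
  · intro hX0 γ hγ
    obtain ⟨hγ0, hγα⟩ := hγ
    set δ := 2 * (α - γ) with hδ
    have hδ0 : 0 < δ := by rw [hδ]; linarith
    set q : ℝ := (1 / 2 : ℝ) ^ δ with hq
    have hq0 : 0 < q := by positivity
    have hq1 : q < 1 := Real.rpow_lt_one (by norm_num) (by norm_num) hδ0
    have hS := summable_aux q hq0.le hq1
    set S := ∑' j : ℕ, ((j : ℝ) + 1) * q ^ j with hSdef
    have hS0 : 0 < S := hS.tsum_pos (fun j => by positivity) 0 (by simp)
    set c1 := K * (S * T ^ δ) with hc1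
    have hc1p : 0 < c1 := by positivity
    set c2 := c1 * T ^ (2 * γ) with hc2
    have hc2p : 0 < c2 := by positivity
    refine ⟨1 / (c1 + c2), by positivity, _, hZi, ?_⟩
    filter_upwards [hmain] with ω ⟨hM1, hω⟩
    have hL0 : 0 ≤ Real.log (M ω) := Real.log_nonneg hM1
    have hmain2 : ∀ s ∈ Set.Icc 0 T, ∀ t ∈ Set.Icc 0 T, s ≠ t →
        ‖X t ω - X s ω‖ ^ 2 ≤ c1 * (2 + Real.log (M ω)) * |t - s| ^ (2 * γ) := by
      intro s hs t ht hst
      obtain ⟨n, hn, hb⟩ := hω s hs t ht hst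
      have hr0 : 0 < |t - s| := abs_pos.2 (sub_ne_zero.2 hst.symm)
      set r := |t - s| with hr
      have h1 : r ^ δ ≤ T ^ δ * q ^ n := by
        have h2 : r ≤ T * (1 / 2) ^ n := by
          rw [div_pow, one_pow, mul_one_div, le_div_iff₀ (by positivity)]; exact hn
        calc r ^ δ ≤ (T * (1 / 2) ^ n) ^ δ := Real.rpow_le_rpow hr0.le h2 hδ0.le
          _ = _ := by
            rw [Real.mul_rpow hT.le (by positivity), hq]
            congr 1
            rw [← Real.rpow_natCast, ← Real.rpow_natCast, ← Real.rpow_mul (by norm_num),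
              ← Real.rpow_mul (by norm_num), mul_comm]
      have h3 : ((n : ℝ) + 1) * q ^ n ≤ S := hS.le_tsum n (fun j _ => by positivity)
      have e : r ^ (2 * α) = r ^ δ * r ^ (2 * γ) := by
        rw [← Real.rpow_add hr0]; congr 1; rw [hδ]; ring
      calc _ ≤ K * (n + 1) * (2 + Real.log (M ω)) * r ^ (2 * α) := hb
        _ = K * (n + 1) * (2 + Real.log (M ω)) * (r ^ δ * r ^ (2 * γ)) := by rw [e]
        _ ≤ K * (n + 1) * (2 + Real.log (M ω)) * ((T ^ δ * q ^ n) * r ^ (2 * γ)) := by gcongr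
        _ = K * (((n + 1) * q ^ n) * T ^ δ) * (2 + Real.log (M ω)) * r ^ (2 * γ) := by ring
        _ ≤ K * (S * T ^ δ) * (2 + Real.log (M ω)) * r ^ (2 * γ) := by gcongr
    intro s hs t ht hst
    have hβ1 : 1 / (c1 + c2) * c1 ≤ 1 := by
      rw [one_div_mul_eq_div, div_le_one (by positivity)]; linarith
    have hβ2 : 1 / (c1 + c2) * c2 ≤ 1 := by
      rw [one_div_mul_eq_div, div_le_one (by positivity)]; linarith
    constructor
    · have hr0 : 0 < |t - s| := abs_pos.2 (sub_ne_zero.2 hst.symm)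
      refine le_of_exp_aux _ c1 _ _ hc1p hM1 (by positivity) hβ1 ?_
      rw [div_pow, hpow2 _ γ hr0.le, div_le_iff₀ (by positivity)]
      exact hmain2 s hs t ht hst
    · refine le_of_exp_aux _ c2 _ _ hc2p hM1 (by positivity) hβ2 ?_
      by_cases h0 : t = 0
      · rw [h0, hX0]; simp; positivity
      · have h := hmain2 0 ⟨le_rfl, hT.le⟩ t ht (Ne.symm h0)
        rw [hX0, sub_zero, sub_zero, abs_of_nonneg ht.1] at h
        have h2 : t ^ (2 * γ) ≤ T ^ (2 * γ) := Real.rpow_le_rpow ht.1 ht.2 (by positivity)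
        calc _ ≤ c1 * (2 + Real.log (M ω)) * t ^ (2 * γ) := h
          _ ≤ c1 * (2 + Real.log (M ω)) * T ^ (2 * γ) := by gcongr
          _ = _ := by rw [hc2]; ring
end
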